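/- Let n be a positive integer and k a field with char k = 0 or char k = p > n. Let λ₁,…,λ_n be elements of the field of formal Laurent series k((t)) such that for every j with 1 ≤ j ≤ n, the power sum λ₁^j + λ₂^j + ⋯ + λ_n^j lies in the subring of formal power series k[[t]]. Then λ_i ∈ k[[t]] for every 1 ≤ i ≤ n. -/

import Mathlib

open MvPolynomial in
/-- If the power sums of `f` of degree `1, …, card σ` lie in a subring containing the inverses of
`1, …, card σ`, then so do the elementary symmetric functions of `f`. -/
theorem Subring.aeval_esymm_mem_of_sum_pow_mem {σ K : Type*} [Fintype σ] [Field K]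
    (S : Subring K) (f : σ → K)
    (hinv : ∀ j : ℕ, 1 ≤ j → j ≤ Fintype.card σ → (j : K) ≠ 0 ∧ (j : K)⁻¹ ∈ S)
    (hsum : ∀ j : ℕ, 1 ≤ j → j ≤ Fintype.card σ → ∑ i, f i ^ j ∈ S)
    (j : ℕ) (hj : j ≤ Fintype.card σ) : aeval f (esymm σ ℤ j) ∈ S := by
  induction j using Nat.strong_induction_on with
  | _ j ih =>
    rcases Nat.eq_zero_or_pos j with rfl | hpos
    · simp
    · obtain ⟨hne, hmem⟩ := hinv j hpos hj
      have hnewton := congrArg (aeval f) (mul_esymm_eq_sum σ ℤ j)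
      simp only [map_mul, map_natCast, map_sum, map_pow, map_neg, map_one] at hnewton
      rw [← inv_mul_cancel_left₀ hne (aeval f (esymm σ ℤ j)), hnewton]
      have hneg : (-1 : K) ∈ S := S.neg_mem S.one_mem
      refine S.mul_mem hmem (S.mul_mem (S.pow_mem hneg _) (S.sum_mem fun a ha => ?_))
      simp only [Finset.mem_filter, Finset.HasAntidiagonal.mem_antidiagonal] at ha
      refine S.mul_mem (S.mul_mem (S.pow_mem hneg _) (ih a.1 ha.2 (by lia))) ?_
      simpa [psum] using hsum a.2 (by lia) (by lia)

open Polynomial in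
/-- If the elementary symmetric functions of `f` come from `R`, then each value of `f` is
integral over `R`. -/
theorem isIntegral_of_aeval_esymm_mem_range {σ R K : Type*} [Fintype σ] [CommRing R] [CommRing K]
    [Algebra R K] (f : σ → K)
    (h : ∀ j ≤ Fintype.card σ,
      MvPolynomial.aeval f (MvPolynomial.esymm σ ℤ j) ∈ (algebraMap R K).range)
    (i : σ) : IsIntegral R (f i) := by
  nontriviality K
  set s : Multiset K := Finset.univ.val.map f with hs
  set p : K[X] := (s.map fun a => X - C a).prod with hp
  have hcard : Multiset.card s = Fintype.card σ := by simp [hs]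
  have hlift : p ∈ lifts (algebraMap R K) := by
    rw [hp, Multiset.prod_X_sub_X_eq_sum_esymm]
    refine sum_mem fun j hj => ?_
    rw [Finset.mem_range, hcard] at hj
    obtain ⟨r, hr⟩ := h j (by lia)
    rw [MvPolynomial.aeval_esymm_eq_multiset_esymm] at hr
    rw [← hr]
    refine mul_mem (pow_mem ?_ _) (mul_mem (C_mem_lifts _ _) (pow_mem (X_mem_lifts _) _))
    exact (lifts_iff_liftsRing (algebraMap R K) _).2 (neg_mem (one_mem _))
  have hmonic : p.Monic := monic_multiset_prod_of_monic _ _ fun a _ => monic_X_sub_C a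
  obtain ⟨q, hq, -, hqm⟩ := lifts_and_degree_eq_and_monic hlift hmonic
  refine ⟨q, hqm, ?_⟩
  rw [← eval_map, hq, hp, eval_multiset_prod]
  refine Multiset.prod_eq_zero (Multiset.mem_map.2 ⟨X - C (f i), ?_, by simp⟩)
  exact Multiset.mem_map.2 ⟨f i, by simp [hs], rfl⟩

theorem LaurentSeries.mem_range_algebraMap_iff {k : Type*} [Field k] (x : LaurentSeries k) :
    x ∈ (algebraMap (PowerSeries k) (LaurentSeries k)).range ↔
      ∀ m : ℤ, m < 0 → x.coeff m = 0 := by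
  constructor
  · rintro ⟨y, rfl⟩ m hm
    rw [LaurentSeries.coe_algebraMap]
    exact HahnSeries.embDomain_of_notMem_range (by simp; lia)
  · intro h
    refine ⟨PowerSeries.mk fun j => x.coeff j, ?_⟩
    rw [LaurentSeries.coe_algebraMap]
    ext m
    rcases lt_or_ge m 0 with hm | hm
    · rw [h m hm]
      exact HahnSeries.embDomain_of_notMem_range (by simp; lia)
    · lift m to ℕ using hm
      simp

/-- Let `k` be a field with `char k = 0` or `char k = p > n`, and let
`λ₁, …, λₙ` be formal Laurent series over `k`.  If for every `1 ≤ j ≤ n` the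
power sum `λ₁^j + ⋯ + λₙ^j` is a power series (all coefficients in negative
degrees vanish), then each `λᵢ` is a power series. -/
theorem statement_18
    (k : Type) [Field k] (n : ℕ) (hn : 0 < n)
    (hchar : ringChar k = 0 ∨ n < ringChar k)
    (lam : Fin n → LaurentSeries k)
    (hsum : ∀ j : ℕ, 1 ≤ j → j ≤ n →
      ∀ m : ℤ, m < 0 → (∑ i, (lam i) ^ j).coeff m = 0) :
    ∀ i, ∀ m : ℤ, m < 0 → (lam i).coeff m = 0 := by
  intro i
  rw [← LaurentSeries.mem_range_algebraMap_iff]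
  refine IsIntegrallyClosed.isIntegral_iff.1 (isIntegral_of_aeval_esymm_mem_range lam ?_ i)
  refine Subring.aeval_esymm_mem_of_sum_pow_mem _ lam (fun j hj hjn => ?_) fun j hj hjn => ?_
  · rw [Fintype.card_fin] at hjn
    have hk : (j : k) ≠ 0 := by
      rw [Ne, ringChar.spec]
      intro hdvd
      rcases hchar with h0 | hlt
      · rw [h0, zero_dvd_iff] at hdvd
        lia
      · exact absurd (Nat.le_of_dvd hj hdvd) (by lia)
    have hmap : algebraMap k (LaurentSeries k) j = j := map_natCast _ j
    refine ⟨by rwa [← hmap, Ne, map_eq_zero], algebraMap k (PowerSeries k) (j : k)⁻¹, ?_⟩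
    refine eq_inv_of_mul_eq_one_left ?_
    rw [← map_natCast (algebraMap (PowerSeries k) (LaurentSeries k)) j, ← map_mul,
      ← map_natCast (algebraMap k (PowerSeries k)) j, ← map_mul, inv_mul_cancel₀ hk,
      map_one, map_one]
  · rw [Fintype.card_fin] at hjn
    exact (LaurentSeries.mem_range_algebraMap_iff _).2 (hsum j hj hjn)
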